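/- arXiv:1506.02490 — 5 statements merged into one kernel-verified Lean document; each statement's English description precedes it below -/
import Mathlib

section
/- Let R > 1, let f : ℂ → ℂ be analytic on D_R = {z : |z| < R} with power series f(z) = Σ_{j=0}^{∞} c_j z^j, and let n ≥ 1 be an integer. Then for every z with |z| ≤ R₁, where 1 ≤ R₁ < R, the series Σ_{j=0}^{∞} c_j L_n(e_j)(z) converges and L_n(f)(z) = Σ_{j=0}^{∞} c_j L_n(e_j)(z). -/
open Finset Metric

/-- The complex Lorentz operator. -/
noncomputable def lorentzOp (n : ℕ) (f : ℂ → ℂ) : ℂ → ℂ :=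
  fun z => ∑ k ∈ Finset.range (n + 1),
    (n.choose k : ℂ) * (z / (n : ℂ)) ^ k * iteratedDeriv k f 0

lemma iteratedDeriv_of_series (f : ℂ → ℂ) (c : ℕ → ℂ) (R : ℝ) (hR : 0 < R)
    (hf : ∀ z ∈ ball (0 : ℂ) R, HasSum (fun j => c j * z ^ j) (f z)) (k : ℕ) :
    iteratedDeriv k f 0 = (k.factorial : ℂ) * c k := by
  have h1 : HasFPowerSeriesAt f (FormalMultilinearSeries.ofScalars ℂ c) 0 := by
    rw [hasFPowerSeriesAt_iff]
    filter_upwards [ball_mem_nhds (0 : ℂ) hR] with z hz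
    simpa [FormalMultilinearSeries.coeff_ofScalars, mul_comm] using hf z hz
  have h2 := h1.analyticAt.hasFPowerSeriesAt
  have h3 := congrArg (fun p => FormalMultilinearSeries.coeff p k) (h1.eq_formalMultilinearSeries h2)
  simp only [FormalMultilinearSeries.coeff_ofScalars] at h3
  have : (k.factorial : ℂ) ≠ 0 := by exact_mod_cast k.factorial_ne_zero
  rw [h3]
  field_simp

lemma iteratedDeriv_monomial (j k : ℕ) :
    iteratedDeriv k (fun w : ℂ => w ^ j) 0 = if j = k then (k.factorial : ℂ) else 0 := by
  rw [iteratedDeriv_of_series _ (fun i => if i = j then 1 else 0) 1 one_pos]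
  · by_cases h : j = k
    · simp [h]
    · simp [h, Ne.symm h]
  · intro z _
    convert hasSum_ite_eq j (z ^ j) using 2 with i
    by_cases h : i = j <;> simp [h]

theorem lorentz_series_expansion (R R₁ : ℝ) (hR : 1 < R) (hR₁ : 1 ≤ R₁) (hRR : R₁ < R)
    (n : ℕ) (hn : 1 ≤ n) (f : ℂ → ℂ) (c : ℕ → ℂ)
    (hf : ∀ z ∈ ball (0 : ℂ) R, HasSum (fun j => c j * z ^ j) (f z))
    (z : ℂ) (hz : ‖z‖ ≤ R₁) :
    HasSum (fun j => c j * lorentzOp n (fun w => w ^ j) z) (lorentzOp n f z) := by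
  simp only [lorentzOp, Finset.mul_sum]
  apply hasSum_sum
  intro k _
  rw [iteratedDeriv_of_series f c R (by linarith) hf k]
  convert hasSum_ite_eq k
    ((n.choose k : ℂ) * (z / (n : ℂ)) ^ k * ((k.factorial : ℂ) * c k)) using 2 with j
  rw [iteratedDeriv_monomial]
  by_cases h : j = k
  · subst h
    simp only [if_true]
    ring
  · simp [h]
end

section
/- Let n ≥ 0 and let p be a real polynomial of degree at most n with Lorentz representation p(x) = Σ_{k=0}^{n} c_k x^k (1−x)^{n−k}, where c_k ∈ ℝ. Then for every 0 ≤ k ≤ n, |c_k| ≤ d_{n,k} · max_{x ∈ [0,1]} |p(x)|, where d_{n,k} = Σ_{j=0}^{min(k,n−k)} C(n,2j) C(n−2j, k−j) 4^j. -/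
open Finset

/-- The Lubinsky–Ziegler coefficients `d_{n,k}`. -/
def dCoef (n k : ℕ) : ℕ :=
  ∑ j ∈ Finset.range (min k (n - k) + 1),
    n.choose (2 * j) * (n - 2 * j).choose (k - j) * 4 ^ j

section aux
open Polynomial

theorem lz_choose_eq (n k : ℕ) (hk : k ≤ n) : (2 * n).choose (2 * k) = dCoef n k := by
  have h1 : ((1 + X : ℕ[X]) ^ (2 * n)).coeff (2 * k) = (2 * n).choose (2 * k) := by
    rw [Polynomial.coeff_one_add_X_pow]; simp
  have h2 : (1 + X : ℕ[X]) ^ (2 * n) = (C 2 * X + expand ℕ 2 (1 + X)) ^ n := by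
    rw [pow_mul]; congr 1
    simp only [map_add, map_one, expand_X, map_ofNat]
    ring
  have h3 : ∀ m ∈ range (n + 1), ((C 2 * X : ℕ[X]) ^ m * (expand ℕ 2 (1 + X)) ^ (n - m)
      * (n.choose m : ℕ[X])).coeff (2 * k) =
      if m ≤ 2 * k ∧ 2 ∣ (2 * k - m) then 2 ^ m * (n - m).choose ((2 * k - m) / 2) * n.choose m
      else 0 := by
    intro m _
    rw [← map_pow, mul_pow, ← C_pow, mul_assoc (C _), ← C_eq_natCast, coeff_mul_C, coeff_C_mul,
      coeff_X_pow_mul', coeff_expand (by norm_num)]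
    simp only [Polynomial.coeff_one_add_X_pow]
    split_ifs <;> simp_all
  rw [h2, add_pow, finsetSum_coeff, sum_congr rfl h3, ← sum_filter] at h1
  rw [← h1, dCoef]
  symm
  have h4 : ∑ j ∈ range (min k (n - k) + 1), n.choose (2 * j) * (n - 2 * j).choose (k - j) * 4 ^ j
      = ∑ j ∈ (range (n + 1)).filter (fun j => 2 * j ≤ n ∧ j ≤ k),
        n.choose (2 * j) * (n - 2 * j).choose (k - j) * 4 ^ j := by
    apply sum_subset
    · intro j hj
      simp only [mem_range, mem_filter] at *
      omega
    · intro j hj hj'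
      simp only [mem_range, mem_filter] at *
      rw [Nat.choose_eq_zero_of_lt (n := n - 2 * j)]
      · simp
      · omega
  rw [h4]
  apply sum_bij (fun j _ => 2 * j)
  · intro j hj
    simp only [mem_range, mem_filter] at *
    omega
  · intro a _ b _ h
    omega
  · intro m hm
    simp only [mem_range, mem_filter] at hm
    refine ⟨m / 2, ?_, ?_⟩
    · simp only [mem_range, mem_filter]; omega
    · omega
  · intro j hj
    rw [show (2 * k - 2 * j) / 2 = k - j by omega, pow_mul]
    norm_num
    ring

theorem lz_sum_split (f : ℕ → ℝ) (n : ℕ) : ∑ m ∈ range (2 * n + 1), f m =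
    ∑ i ∈ range (n + 1), f (2 * i) + ∑ i ∈ range n, f (2 * i + 1) := by
  induction n with
  | zero => simp
  | succ n ih =>
    rw [show 2 * (n + 1) + 1 = 2 * n + 1 + 1 + 1 by ring, sum_range_succ, sum_range_succ, ih,
      sum_range_succ _ (n + 1), sum_range_succ _ n]
    rw [sum_range_succ _ n]
    rw [show 2 * (n + 1) = 2 * n + 1 + 1 by ring]
    ring

/-- The homogeneous evaluation. -/
noncomputable def lzF (n : ℕ) (c : ℕ → ℝ) (x : ℝ) : ℝ :=
  ∑ i ∈ range (n + 1), c i * x ^ i * (1 - x) ^ (n - i)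

theorem lz_cheb (n : ℕ) (θ : ℝ) :
    lzF n (fun i => (-1) ^ (n - i) * ((2 * n).choose (2 * i) : ℝ)) (Real.cos θ ^ 2)
      = Real.cos (2 * n * θ) := by
  have h := Complex.cos_add_sin_mul_I_pow (2 * n) (θ : ℂ)
  have h' := congrArg Complex.re h
  have e1 : (Complex.cos (((2 * n : ℕ) : ℂ) * (θ : ℂ)) +
      Complex.sin (((2 * n : ℕ) : ℂ) * (θ : ℂ)) * Complex.I).re = Real.cos (2 * n * θ) := by
    have : (((2 * n : ℕ) : ℂ) * (θ : ℂ)) = ((2 * n * θ : ℝ) : ℂ) := by push_cast; ring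
    rw [this, ← Complex.ofReal_cos, ← Complex.ofReal_sin]
    simp [-Complex.ofReal_cos, -Complex.ofReal_sin]
  rw [e1, add_pow, Complex.re_sum, lz_sum_split] at h'
  have hI : ∀ r : ℕ, ((Complex.sin θ * Complex.I) ^ (2 * r)) =
      (((-1) ^ r * (1 - Real.cos θ ^ 2) ^ r : ℝ) : ℂ) := by
    intro r
    rw [pow_mul, mul_pow, Complex.I_sq, ← Real.sin_sq]
    push_cast
    rw [mul_neg_one, neg_pow]
  rw [← h', lzF]
  have hz : ∑ i ∈ range n, (Complex.cos (θ : ℂ) ^ (2 * i + 1) * (Complex.sin θ * Complex.I) ^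
      (2 * n - (2 * i + 1)) * ((2 * n).choose (2 * i + 1) : ℂ)).re = 0 := by
    apply sum_eq_zero
    intro i hi
    have hi := mem_range.1 hi
    rw [show 2 * n - (2 * i + 1) = 2 * (n - i - 1) + 1 by omega, pow_succ _ (2 * (n - i - 1)), hI,
      ← Complex.ofReal_cos, ← Complex.ofReal_sin]
    have : ∀ a b s d : ℝ, ((a : ℂ) * ((b : ℂ) * ((s : ℂ) * Complex.I)) * (d : ℂ)).re = 0 := by
      intro a b s d
      have : ((a : ℂ) * ((b : ℂ) * ((s : ℂ) * Complex.I)) * (d : ℂ)) =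
        ((a * b * s * d : ℝ) : ℂ) * Complex.I := by push_cast; ring
      rw [this, Complex.re_ofReal_mul]; simp
    have h2 := this (Real.cos θ ^ (2 * i + 1)) ((-1) ^ (n - i - 1) * (1 - Real.cos θ ^ 2) ^ (n - i - 1))
      (Real.sin θ) ((2 * n).choose (2 * i + 1))
    rw [Complex.ofReal_pow, Complex.ofReal_natCast] at h2
    exact h2
  rw [hz, add_zero]
  apply sum_congr rfl
  intro i hi
  have hi := mem_range.1 hi
  rw [show 2 * n - 2 * i = 2 * (n - i) by omega, hI, ← Complex.ofReal_cos, ← Complex.ofReal_pow,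
    ← Complex.ofReal_natCast, ← Complex.ofReal_mul, ← Complex.ofReal_mul, Complex.ofReal_re]
  ring

/-- Product of homogeneous linear factors. -/
noncomputable def lzL (x : ℕ → ℝ) (s : Finset ℕ) : ℝ[X] :=
  ∏ i ∈ s, (C (1 - x i) * X - C (x i))

theorem lzL_insert (x : ℕ → ℝ) (s : Finset ℕ) (a : ℕ) (ha : a ∉ s) :
    lzL x (insert a s) = C (1 - x a) * (lzL x s * X) - C (x a) * lzL x s := by
  rw [lzL, prod_insert ha, ← lzL]; ring

theorem lzL_coeff_high (x : ℕ → ℝ) (s : Finset ℕ) : ∀ k, #s < k → (lzL x s).coeff k = 0 := by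
  induction s using Finset.induction_on with
  | empty => intro k hk; simp [lzL, coeff_one]; intro h; simp [h] at hk
  | insert a s ha ih =>
    intro k hk
    rw [card_insert_of_notMem ha] at hk
    obtain ⟨k, rfl⟩ := Nat.exists_eq_succ_of_ne_zero (show k ≠ 0 by omega)
    rw [lzL_insert _ _ _ ha, coeff_sub, coeff_C_mul, coeff_C_mul, Nat.succ_eq_add_one,
      coeff_mul_X, ih k (by omega), ih (k + 1) (by omega)]
    simp

theorem lzL_sign (x : ℕ → ℝ) (hx : ∀ i, 0 ≤ x i ∧ x i ≤ 1) (s : Finset ℕ) :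
    ∀ k, 0 ≤ (-1) ^ (#s + k) * (lzL x s).coeff k := by
  induction s using Finset.induction_on with
  | empty => intro k; simp [lzL, coeff_one]; split_ifs with h <;> simp [h]
  | insert a s ha ih =>
    intro k
    rw [lzL_insert _ _ _ ha, coeff_sub, coeff_C_mul, coeff_C_mul, card_insert_of_notMem ha]
    have hb : 0 ≤ 1 - x a := by linarith [(hx a).2]
    cases k with
    | zero =>
      have := mul_nonneg (hx a).1 (ih 0)
      simp only [coeff_mul_X_zero]
      rw [show #s + 1 + 0 = #s + 1 by ring, pow_succ]
      rw [add_zero] at this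
      linarith
    | succ k =>
      have h1 := mul_nonneg (hx a).1 (ih (k + 1))
      have h2 := mul_nonneg hb (ih k)
      rw [coeff_mul_X, show #s + 1 + (k + 1) = (#s + k) + 1 + 1 by ring, pow_succ, pow_succ]
      rw [show #s + (k + 1) = (#s + k) + 1 by ring, pow_succ] at h1
      linarith

theorem lzL_eval (x : ℕ → ℝ) (s : Finset ℕ) (y : ℝ) :
    lzF #s (fun i => (lzL x s).coeff i) y = ∏ i ∈ s, (y - x i) := by
  induction s using Finset.induction_on with
  | empty => simp [lzL, lzF]
  | insert a s ha ih =>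
    rw [prod_insert ha, ← ih, card_insert_of_notMem ha]
    simp only [lzL_insert _ _ _ ha, coeff_sub, coeff_C_mul]
    have e1 : lzF (#s + 1) (fun i => (lzL x s * X).coeff i) y
        = y * lzF #s (fun i => (lzL x s).coeff i) y := by
      rw [lzF, sum_range_succ', lzF, mul_sum]
      simp only [coeff_mul_X, coeff_mul_X_zero, Nat.add_sub_add_right, zero_mul, add_zero]
      apply sum_congr rfl; intros; ring
    have e2 : lzF (#s + 1) (fun i => (lzL x s).coeff i) y
        = (1 - y) * lzF #s (fun i => (lzL x s).coeff i) y := by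
      rw [lzF, sum_range_succ, lzL_coeff_high x s (#s + 1) (by omega), lzF, mul_sum]
      simp only [zero_mul, add_zero]
      apply sum_congr rfl; intro i hi
      have := mem_range.1 hi
      rw [show #s + 1 - i = (#s - i) + 1 by omega]; ring
    have e3 : lzF (#s + 1) (fun i => (1 - x a) * (lzL x s * X).coeff i - x a * (lzL x s).coeff i) y
        = (1 - x a) * lzF (#s + 1) (fun i => (lzL x s * X).coeff i) y
          - x a * lzF (#s + 1) (fun i => (lzL x s).coeff i) y := by
      simp only [lzF, mul_sum, ← sum_sub_distrib]
      apply sum_congr rfl; intros; ring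
    rw [e3, e1, e2]; ring

theorem lz_zero (n : ℕ) (e : ℕ → ℝ) (x : ℕ → ℝ) (hinj : Set.InjOn x (range (n + 1)))
    (h : ∀ m ∈ range (n + 1), lzF n e (x m) = 0) (k : ℕ) (hk : k ≤ n) : e k = 0 := by
  set P : ℝ[X] := ∑ i ∈ range (n + 1), C (e i) * X ^ i * (1 - X) ^ (n - i) with hP
  have hev : ∀ y, P.eval y = lzF n e y := by
    intro y; simp [hP, lzF, eval_finsetSum]
  have hdeg : P.natDegree ≤ n := by
    apply natDegree_sum_le_of_forall_le
    intro i hi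
    have := mem_range.1 hi
    have h1 : (1 - X : ℝ[X]).natDegree ≤ 1 := by compute_degree
    have h2 : ((1 - X : ℝ[X]) ^ (n - i)).natDegree ≤ (n - i) * 1 := natDegree_pow_le_of_le _ h1
    have h3 := natDegree_C_mul_X_pow_le (e i) i
    have := natDegree_mul_le_of_le h3 h2
    omega
  have hP0 : P = 0 := by
    apply eq_zero_of_natDegree_lt_card_of_eval_eq_zero' P ((range (n + 1)).image x)
    · intro y hy
      obtain ⟨m, hm, rfl⟩ := mem_image.1 hy
      rw [hev, h m hm]
    · rw [card_image_of_injOn hinj, card_range]; omega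
  set Q : ℝ[X] := ∑ i ∈ range (n + 1), C (e i) * X ^ i with hQ
  have hQ0 : Q = 0 := by
    apply eq_zero_of_infinite_isRoot
    apply (Set.Ioi_infinite (0 : ℝ)).mono
    intro t ht
    have ht : 0 < t := ht
    have h0 : lzF n e (t / (1 + t)) = 0 := by rw [← hev, hP0]; simp
    have h1 : Q.eval t = (1 + t) ^ n * lzF n e (t / (1 + t)) := by
      simp only [hQ, eval_finsetSum, lzF, mul_sum]
      apply sum_congr rfl
      intro i hi
      have := mem_range.1 hi
      have h4 : 1 - t / (1 + t) = 1 / (1 + t) := by field_simp; ring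
      rw [h4, show (1 + t) ^ n = (1 + t) ^ i * (1 + t) ^ (n - i) by
        rw [← pow_add]; congr 1; omega]
      rw [div_pow, div_pow]
      simp
      field_simp
    show Q.eval t = 0
    rw [h1, h0, mul_zero]
  have := congrArg (fun q => q.coeff k) hQ0
  simp [hQ, coeff_X_pow] at this
  exact this (by omega)

theorem lz_rep (n : ℕ) (c : ℕ → ℝ) (x : ℕ → ℝ) (hinj : Set.InjOn x (range (n + 1)))
    (k : ℕ) (hk : k ≤ n) : c k = ∑ j ∈ range (n + 1), lzF n c (x j) *
      ((lzL x ((range (n + 1)).erase j)).coeff k / ∏ i ∈ (range (n + 1)).erase j, (x j - x i)) := by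
  rw [← sub_eq_zero]
  refine lz_zero n (fun k => c k - ∑ j ∈ range (n + 1), lzF n c (x j) *
      ((lzL x ((range (n + 1)).erase j)).coeff k / ∏ i ∈ (range (n + 1)).erase j, (x j - x i)))
      x hinj ?_ k hk
  intro m hm
  have e1 : ∀ y, lzF n (fun k => c k - ∑ j ∈ range (n + 1), lzF n c (x j) *
      ((lzL x ((range (n + 1)).erase j)).coeff k / ∏ i ∈ (range (n + 1)).erase j, (x j - x i))) y
      = lzF n c y - ∑ j ∈ range (n + 1), lzF n c (x j) *
       (lzF n (fun k => (lzL x ((range (n + 1)).erase j)).coeff k) y /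
        ∏ i ∈ (range (n + 1)).erase j, (x j - x i)) := by
    intro y
    have : ∀ j, lzF n c (x j) *
       (lzF n (fun k => (lzL x ((range (n + 1)).erase j)).coeff k) y /
        ∏ i ∈ (range (n + 1)).erase j, (x j - x i)) = ∑ k ∈ range (n + 1), lzF n c (x j) *
       ((lzL x ((range (n + 1)).erase j)).coeff k  /
        ∏ i ∈ (range (n + 1)).erase j, (x j - x i)) * y ^ k * (1 - y) ^ (n - k) := by
      intro j
      generalize lzF n c (x j) = A
      rw [lzF, sum_div, mul_sum]
      apply sum_congr rfl; intros; ring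
    simp only [this]
    rw [sum_comm]
    conv_lhs => rw [lzF]
    conv_rhs => enter [1]; rw [lzF]
    rw [← sum_sub_distrib]
    apply sum_congr rfl; intros
    rw [sub_mul, sub_mul, sum_mul, sum_mul]
  rw [e1, sub_eq_zero]
  have e2 : ∀ j ∈ range (n + 1), ∀ y, lzF n (fun k => (lzL x ((range (n + 1)).erase j)).coeff k) y
      = ∏ i ∈ (range (n + 1)).erase j, (y - x i) := by
    intro j hj y
    rw [← lzL_eval, card_erase_of_mem hj, card_range]; rfl
  symm
  rw [sum_eq_single_of_mem m hm]
  · rw [e2 m hm, div_self, mul_one]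
    rw [prod_ne_zero_iff]
    intro i hi
    rw [sub_ne_zero]
    intro h
    exact (ne_of_mem_erase hi) (hinj (mem_of_mem_erase hi) hm h.symm)
  · intro j hj hne
    rw [e2 j hj, prod_eq_zero (i := m)]
    · simp
    · exact mem_erase.2 ⟨hne.symm, hm⟩
    · simp

theorem lz_prod_sign (n : ℕ) (x : ℕ → ℝ) (hx : StrictAntiOn x (range (n + 1))) (j : ℕ)
    (hj : j ∈ range (n + 1)) : 0 < (-1) ^ j * ∏ i ∈ (range (n + 1)).erase j, (x j - x i) := by
  have h1 : (range (n + 1)).erase j = range j ∪ Ioo j (n + 1) := by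
    have := mem_range.1 hj
    ext i; simp only [mem_erase, mem_range, mem_union, mem_Ioo]; omega
  have hd : Disjoint (range j) (Ioo j (n + 1)) := by
    rw [disjoint_left]; intro i; simp only [mem_range, mem_Ioo]; omega
  have hj' := mem_range.1 hj
  rw [h1, prod_union hd, ← mul_assoc]
  have h2 : (-1 : ℝ) ^ j = ∏ i ∈ range j, (-1) := by simp
  rw [h2, ← prod_mul_distrib]
  apply mul_pos
  · apply prod_pos
    intro i hi
    have hi := mem_range.1 hi
    have := hx (show i ∈ (range (n + 1) : Set ℕ) by simp; omega) hj hi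
    linarith
  · apply prod_pos
    intro i hi
    have hi := mem_Ioo.1 hi
    have := hx hj (show i ∈ (range (n + 1) : Set ℕ) by simp; omega) hi.1
    linarith

end aux

theorem lubinsky_ziegler_coefficient_bound (n : ℕ) (c : ℕ → ℝ) (k : ℕ) (hk : k ≤ n) :
    |c k| ≤ (dCoef n k : ℝ) *
      ⨆ x : Set.Icc (0 : ℝ) 1,
        |∑ i ∈ Finset.range (n + 1), c i * (x : ℝ) ^ i * (1 - (x : ℝ)) ^ (n - i)| := by
  set M := ⨆ x : Set.Icc (0 : ℝ) 1,
        |∑ i ∈ Finset.range (n + 1), c i * (x : ℝ) ^ i * (1 - (x : ℝ)) ^ (n - i)| with hM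
  have hbdd : BddAbove (Set.range fun x : Set.Icc (0 : ℝ) 1 =>
      |∑ i ∈ Finset.range (n + 1), c i * (x : ℝ) ^ i * (1 - (x : ℝ)) ^ (n - i)|) := by
    apply IsCompact.bddAbove
    apply isCompact_range
    fun_prop
  have hle : ∀ y : ℝ, 0 ≤ y → y ≤ 1 → |lzF n c y| ≤ M := fun y h0 h1 =>
    le_ciSup hbdd (⟨y, h0, h1⟩ : Set.Icc (0 : ℝ) 1)
  set x : ℕ → ℝ := fun j => Real.cos (j * Real.pi / (2 * n)) ^ 2 with hxdef
  have hx01 : ∀ i, 0 ≤ x i ∧ x i ≤ 1 := fun i => ⟨sq_nonneg _, Real.cos_sq_le_one _⟩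
  have hanti : StrictAntiOn x (range (n + 1)) := by
    intro a ha b hb hab
    simp only [coe_range, Set.mem_Iio] at ha hb
    have hn : (0 : ℝ) < n := by
      have : 0 < n := by omega
      exact_mod_cast this
    have hab' : (a : ℝ) < b := by exact_mod_cast hab
    have hbn : (b : ℝ) ≤ n := by
      have : b ≤ n := by omega
      exact_mod_cast this
    have hpi := Real.pi_pos
    have h1 : (a : ℝ) * Real.pi / (2 * n) < b * Real.pi / (2 * n) := by gcongr
    have h2 : (b : ℝ) * Real.pi / (2 * n) ≤ Real.pi / 2 := by
      rw [div_le_div_iff₀ (by positivity) (by positivity)]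
      nlinarith
    have h0 : 0 ≤ (a : ℝ) * Real.pi / (2 * n) := by positivity
    have h3 := Real.cos_lt_cos_of_nonneg_of_le_pi_div_two h0 h2 h1
    have h4 : 0 ≤ Real.cos (b * Real.pi / (2 * n)) :=
      Real.cos_nonneg_of_mem_Icc ⟨by linarith, h2⟩
    exact pow_lt_pow_left₀ h3 h4 (by norm_num)
  set l : ℕ → ℝ := fun j => ((lzL x ((range (n + 1)).erase j)).coeff k /
    ∏ i ∈ (range (n + 1)).erase j, (x j - x i)) with hl
  have hsign : ∀ j ∈ range (n + 1), 0 ≤ (-1) ^ (n + k) * ((-1) ^ j * l j) := by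
    intro j hj
    have h1 := lzL_sign x hx01 ((range (n + 1)).erase j) k
    rw [card_erase_of_mem hj, card_range, Nat.add_sub_cancel] at h1
    have h2 := lz_prod_sign n x hanti j hj
    have h3 := div_nonneg h1 h2.le
    have h4 : ((-1 : ℝ) ^ j)⁻¹ = (-1) ^ j := by
      rw [← inv_pow]; norm_num
    rw [mul_div_mul_comm, div_eq_mul_inv _ ((-1 : ℝ) ^ j), h4] at h3
    rw [← mul_assoc]; exact h3
  have hrep := lz_rep n c x hanti.injOn k hk
  have hrepT := lz_rep n (fun i => (-1) ^ (n - i) * ((2 * n).choose (2 * i) : ℝ)) x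
    hanti.injOn k hk
  have hT : ∀ j ∈ range (n + 1),
      lzF n (fun i => (-1) ^ (n - i) * ((2 * n).choose (2 * i) : ℝ)) (x j) = (-1) ^ j := by
    intro j hj
    have := mem_range.1 hj
    simp only [hxdef]
    rw [lz_cheb]
    rcases Nat.eq_zero_or_pos n with h | h
    · have : j = 0 := by omega
      simp [this, h]
    · have : (n : ℝ) ≠ 0 := by positivity
      rw [show 2 * (n : ℝ) * (j * Real.pi / (2 * n)) = j * Real.pi by field_simp]
      exact Real.cos_nat_mul_pi j
  have habs : ∀ j ∈ range (n + 1), |l j| = (-1) ^ (n + k) * ((-1) ^ j * l j) := by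
    intro j hj
    rw [← abs_of_nonneg (hsign j hj)]
    simp [abs_mul]
  have hsum : ∑ j ∈ range (n + 1), |l j| = (dCoef n k : ℝ) := by
    rw [sum_congr rfl habs, ← mul_sum]
    have : ∑ j ∈ range (n + 1), (-1) ^ j * l j = (-1) ^ (n - k) * ((2 * n).choose (2 * k) : ℝ) := by
      rw [hrepT]
      apply sum_congr rfl
      intro j hj
      rw [hT j hj]
    rw [this, lz_choose_eq n k hk, ← mul_assoc, ← pow_add,
      show n + k + (n - k) = 2 * n by omega, pow_mul]
    simp
  rw [hrep, ← hsum, sum_mul]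
  refine (abs_sum_le_sum_abs _ _).trans (sum_le_sum fun j _ => ?_)
  rw [abs_mul, mul_comm]
  exact mul_le_mul_of_nonneg_left (hle _ (hx01 j).1 (hx01 j).2) (abs_nonneg _)
end

section
/- For all integers n ≥ 0 and 0 ≤ k ≤ n, Σ_{j=0}^{min(k,n−k)} C(n,2j) · C(n−2j, k−j) · 4^j = C(2n, 2k), where C(a,b) denotes the binomial coefficient. -/
open Finset

open Polynomial in
theorem aux_coeff (n k m : ℕ) :
    (((2 * X : ℕ[X]) ^ m * (X ^ 2 + 1) ^ (n - m) * ((n.choose m : ℕ) : ℕ[X])).coeff (2 * k)) =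
      n.choose m * (2 ^ m * (if m ≤ 2 * k then
        (if 2 ∣ 2 * k - m then (n - m).choose ((2 * k - m) / 2) else 0) else 0)) := by
  have h1 : (X ^ 2 + 1 : ℕ[X]) ^ (n - m) = expand ℕ 2 ((X + 1) ^ (n - m)) := by simp
  have h2 : (2 * X : ℕ[X]) ^ m * (X ^ 2 + 1) ^ (n - m) * ((n.choose m : ℕ) : ℕ[X]) =
      C (n.choose m) * (C (2 ^ m) * (X ^ m * (X ^ 2 + 1) ^ (n - m))) := by
    have : (C (2 ^ m) : ℕ[X]) = 2 ^ m := by simp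
    rw [this, mul_pow, ← C_eq_natCast]
    simp only [Nat.cast_id]
    ring
  rw [h2, h1, coeff_C_mul, coeff_C_mul, coeff_X_pow_mul', coeff_expand (by norm_num),
    coeff_X_add_one_pow]
  simp

theorem dCoef_eq_central_binomial (n k : ℕ) (hk : k ≤ n) :
    ∑ j ∈ Finset.range (min k (n - k) + 1),
      n.choose (2 * j) * (n - 2 * j).choose (k - j) * 4 ^ j = (2 * n).choose (2 * k) := by
  have key : ((Polynomial.X + 1 : Polynomial ℕ) ^ (2 * n)) =
      (2 * Polynomial.X + (Polynomial.X ^ 2 + 1)) ^ n := by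
    rw [pow_mul]; congr 1; ring
  have h := congrArg (fun p => Polynomial.coeff p (2 * k)) key
  simp only [Polynomial.coeff_X_add_one_pow, add_pow (2 * Polynomial.X),
    Polynomial.finset_sum_coeff, aux_coeff, Nat.cast_id] at h
  rw [h]
  have hinj : Set.InjOn (fun j : ℕ => 2 * j) (Finset.range (min k (n - k) + 1) : Set ℕ) := by
    intro a _ b _ hab
    simp only at hab
    omega
  symm
  rw [← Finset.sum_subset (s₁ := (Finset.range (min k (n - k) + 1)).image (fun j => 2 * j)),
    Finset.sum_image hinj]
  · apply Finset.sum_congr rfl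
    intro j hj
    rw [Finset.mem_range] at hj
    rw [if_pos (by omega), if_pos (by omega), pow_mul,
      show (2 * k - 2 * j) / 2 = k - j by omega]
    norm_num
    ring
  · intro m hm
    simp only [Finset.mem_image, Finset.mem_range] at hm ⊢
    obtain ⟨j, hj, rfl⟩ := hm
    omega
  · intro m hm hm'
    simp only [Finset.mem_image, Finset.mem_range, not_exists, not_and] at hm hm'
    split_ifs with h1 h2
    · have h3 := fun hh => hm' (m / 2) hh
      rw [Nat.choose_eq_zero_of_lt (n := n - m)]
      · simp
      · by_contra hc
        exact h3 (by omega) (by omega)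
    · simp
    · simp
end

section
/- For every integer n ≥ 0 and every real (or complex) x, T_n(2x − 1) = Σ_{k=0}^{n} C(2n, 2k) (−1)^{n−k} x^k (1−x)^{n−k}, where T_n is the n-th Chebyshev polynomial of the first kind. -/
open Finset Polynomial

lemma aux_T (a b : ℂ) (h : a ^ 2 - b ^ 2 = 1) (n : ℕ) :
    2 * (Polynomial.Chebyshev.T ℂ n).eval (a ^ 2 + b ^ 2) =
      (a + b) ^ (2 * n) + (a - b) ^ (2 * n) := by
  induction n using Nat.twoStepInduction with
  | zero => simp; norm_num
  | one => simp; ring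
  | more n ih1 ih2 =>
    have hT : (Polynomial.Chebyshev.T ℂ ((n + 2 : ℕ) : ℤ)) =
        2 * X * Polynomial.Chebyshev.T ℂ ((n + 1 : ℕ) : ℤ) - Polynomial.Chebyshev.T ℂ (n : ℤ) := by
      push_cast
      exact Polynomial.Chebyshev.T_add_two ℂ n
    rw [hT]
    simp only [eval_sub, eval_mul, eval_X, eval_ofNat]
    have e1 : (a + b) ^ 2 * (a - b) ^ 2 = 1 := by
      rw [← mul_pow, show (a + b) * (a - b) = a ^ 2 - b ^ 2 by ring, h, one_pow]
    have e2 : 2 * (a ^ 2 + b ^ 2) = (a + b) ^ 2 + (a - b) ^ 2 := by ring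
    rw [e2, mul_sub, ih1, mul_left_comm, ih2]
    simp only [pow_mul] at *
    generalize (a + b) ^ 2 = u at *
    generalize (a - b) ^ 2 = v at *
    linear_combination (u ^ n + v ^ n) * e1

lemma aux_split (f : ℕ → ℂ) (n : ℕ) : ∑ m ∈ range (2 * n + 1), f m =
    ∑ k ∈ range (n + 1), f (2 * k) + ∑ k ∈ range n, f (2 * k + 1) := by
  induction n with
  | zero => simp
  | succ n ih =>
    rw [show 2 * (n + 1) + 1 = 2 * n + 1 + 1 + 1 by ring, sum_range_succ, sum_range_succ, ih,
      sum_range_succ _ (n + 1), sum_range_succ _ n, sum_range_succ (fun k => f (2 * k + 1)) n,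
      show 2 * (n + 1) = 2 * n + 1 + 1 by ring]
    ring

theorem chebyshev_lorentz_representation (n : ℕ) (x : ℂ) :
    (Polynomial.Chebyshev.T ℂ n).eval (2 * x - 1) =
      ∑ k ∈ Finset.range (n + 1),
        ((2 * n).choose (2 * k) : ℂ) * (-1) ^ (n - k) * x ^ k * (1 - x) ^ (n - k) := by
  obtain ⟨a, ha⟩ := IsAlgClosed.exists_pow_nat_eq x (n := 2) (by norm_num)
  obtain ⟨b, hb⟩ := IsAlgClosed.exists_pow_nat_eq (x - 1) (n := 2) (by norm_num)
  have h := aux_T a b (by rw [ha, hb]; ring) n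
  rw [sub_eq_add_neg a b, add_pow, add_pow, ← sum_add_distrib, aux_split, ha, hb] at h
  have h0 : ∑ k ∈ range n, (a ^ (2 * k + 1) * b ^ (2 * n - (2 * k + 1)) *
      ((2 * n).choose (2 * k + 1) : ℂ) + a ^ (2 * k + 1) * (-b) ^ (2 * n - (2 * k + 1)) *
      ((2 * n).choose (2 * k + 1) : ℂ)) = 0 := by
    apply sum_eq_zero
    intro k hk
    have hk := mem_range.1 hk
    have : Odd (2 * n - (2 * k + 1)) := ⟨n - k - 1, by omega⟩
    rw [this.neg_pow]
    ring
  rw [h0, add_zero] at h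
  apply mul_left_cancel₀ (two_ne_zero' ℂ)
  rw [show 2 * x - 1 = x + (x - 1) by ring, h, mul_sum]
  apply sum_congr rfl
  intro k _
  rw [show 2 * n - 2 * k = 2 * (n - k) by omega, pow_mul, pow_mul, pow_mul, neg_sq, ha, hb,
    show x - 1 = (-1) * (1 - x) by ring, mul_pow]
  ring
end

section
/- For every integer m ≥ 1, max_{0 ≤ k ≤ m} C(2m, 2k) / C(m, k) = C(2m, 2⌊m/2⌋) / C(m, ⌊m/2⌋). -/
lemma ratio_rec (m k : ℕ) (hk : k < m) :
    ((2 * m).choose (2 * (k + 1)) : ℝ) / (m.choose (k + 1) : ℝ) * (2 * k + 1)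
      = ((2 * m).choose (2 * k) : ℝ) / (m.choose k : ℝ) * (2 * m - 2 * k - 1) := by
  obtain ⟨d, rfl⟩ := Nat.exists_eq_add_of_lt hk
  have h1 := Nat.choose_succ_right_eq (2 * (k + d + 1)) (2 * k)
  have h2 := Nat.choose_succ_right_eq (2 * (k + d + 1)) (2 * k + 1)
  have h3 := Nat.choose_succ_right_eq (k + d + 1) k
  rw [show 2 * (k + d + 1) - 2 * k = 2 * d + 2 by omega] at h1
  rw [show 2 * (k + d + 1) - (2 * k + 1) = 2 * d + 1 by omega] at h2
  rw [show k + d + 1 - k = d + 1 by omega] at h3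
  have p1 : (0 : ℝ) < ((k + d + 1).choose k : ℝ) := by
    exact_mod_cast Nat.choose_pos (by omega)
  have p2 : (0 : ℝ) < ((k + d + 1).choose (k + 1) : ℝ) := by
    exact_mod_cast Nat.choose_pos (by omega)
  rw [show 2 * (k + 1) = 2 * k + 1 + 1 by ring]
  generalize (2 * (k + d + 1)).choose (2 * k + 1 + 1) = A at *
  generalize (2 * (k + d + 1)).choose (2 * k + 1) = B at *
  generalize (2 * (k + d + 1)).choose (2 * k) = C at *
  generalize (k + d + 1).choose (k + 1) = D at *
  generalize (k + d + 1).choose k = E at *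
  have h1' : (B : ℝ) * (2 * k + 1) = C * (2 * d + 2) := by exact_mod_cast h1
  have h2' : (A : ℝ) * (2 * k + 1 + 1) = B * (2 * d + 1) := by exact_mod_cast h2
  have h3' : (D : ℝ) * (k + 1) = E * (d + 1) := by exact_mod_cast h3
  have hd : (0 : ℝ) < 2 * ((k : ℝ) + 1) * (d + 1) := by positivity
  rw [div_mul_eq_mul_div, div_mul_eq_mul_div, div_eq_div_iff p2.ne' p1.ne']
  push_cast
  apply mul_right_cancel₀ hd.ne'
  linear_combination (E * (2 * k + 1) * (d + 1) : ℝ) * h2' + (E * (2 * d + 1) * (d + 1) : ℝ) * h1'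
    - (2 * C * (2 * d + 1) * (d + 1) : ℝ) * h3'

theorem binomial_ratio_max (m : ℕ) (hm : 1 ≤ m) :
    IsGreatest
      ((fun k : ℕ => ((2 * m).choose (2 * k) : ℝ) / ((m.choose k : ℝ))) '' {k | k ≤ m})
      (((2 * m).choose (2 * (m / 2)) : ℝ) / ((m.choose (m / 2) : ℝ))) := by
  have hrec := ratio_rec m
  refine ⟨⟨m / 2, Nat.div_le_self m 2, rfl⟩, ?_⟩
  rintro _ ⟨k, hk, rfl⟩
  simp only [Set.mem_setOf_eq] at hk
  set f : ℕ → ℝ := fun k : ℕ => ((2 * m).choose (2 * k) : ℝ) / ((m.choose k : ℝ)) with hf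
  have hnn : ∀ k, 0 ≤ f k := fun k => by simp only [hf]; positivity
  have hr : ∀ k, k < m → f (k + 1) * (2 * k + 1) = f k * (2 * m - 2 * k - 1) := hrec
  change f k ≤ f (m / 2)
  rcases le_total k (m / 2) with h | h
  · induction h using Nat.decreasingInduction with
    | self => exact le_rfl
    | of_succ j hj ih =>
      refine le_trans ?_ (ih (by omega))
      have e := hr j (by omega)
      have c : (2 * j + 1 : ℝ) ≤ m := by exact_mod_cast (by omega : 2 * j + 1 ≤ m)
      have q : (0 : ℝ) < 2 * j + 1 := by positivity
      refine le_of_mul_le_mul_right ?_ q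
      rw [e]
      exact mul_le_mul_of_nonneg_left (by linarith) (hnn j)
  · induction k, h using Nat.le_induction with
    | base => exact le_rfl
    | succ j hj ih =>
      refine le_trans ?_ (ih (by omega))
      have e := hr j (by omega)
      have c : (m : ℝ) ≤ 2 * j + 1 := by exact_mod_cast (by omega : m ≤ 2 * j + 1)
      have q : (0 : ℝ) < 2 * j + 1 := by positivity
      refine le_of_mul_le_mul_right ?_ q
      rw [e]
      exact mul_le_mul_of_nonneg_left (by linarith) (hnn j)
end
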